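/- arXiv:2407.02884 — 3 statements merged into one kernel-verified Lean document; each statement's English description precedes it below -/
import Mathlib

section
/- For every SREMO e over (U,R) there exists an SRT T over U such that Lang(T) = Lang(e) and Match(T,S) = Match(e,S) for every string S over U. -/
open scoped Classical

/-- A valuation over registers `R` with data elements from `U`:
a partial function from registers to data elements. -/
abbrev Val (U R : Type*) := R → Option U

/-- The everywhere-undefined valuation `♯`. -/
def Val.sharp {U R : Type*} : Val U R := fun _ => none

/-- `v.updateW W u` updates every register in `W` to hold `u`. -/
noncomputable def Val.updateW {U R : Type*} (v : Val U R) (W : Set R) (u : U) :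
    Val U R := fun r => if r ∈ W then some u else v r

/-- A condition over `(U, R)`: an arbitrary predicate on pairs of a data
element and a valuation. -/
abbrev Cond (U R : Type*) := U → Val U R → Prop

/-- `MatchCat M₁ M₂ M` states that `M = M₁ · M₂`: `M₁` and `M₂` are disjoint,
`M` is their union, and every position of `M₁` is smaller than every position
of `M₂`. -/
def MatchCat (M₁ M₂ M : Finset ℕ) : Prop :=
  Disjoint M₁ M₂ ∧ M = M₁ ∪ M₂ ∧ ∀ i ∈ M₁, ∀ j ∈ M₂, i < j

/-- Symbolic regular expressions with memory and output over `(U, R)`.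
The output `true` stands for `•` and `false` for `⊗`. -/
inductive SREMO (U R : Type*) where
  | empty : SREMO U R
  | eps : SREMO U R
  | cond (φ : Cond U R) (o : Bool) : SREMO U R
  | condW (φ : Cond U R) (o : Bool) (r : R) : SREMO U R
  | plus (e₁ e₂ : SREMO U R) : SREMO U R
  | cat (e₁ e₂ : SREMO U R) : SREMO U R
  | star (e : SREMO U R) : SREMO U R

/-- The relation `(e, S, M, v) ⊢ v'`, where the `ℕ` argument is the absolute
position (1-based) in the ambient string of the first element of the slice `S`;
positions recorded in `M` are absolute positions. -/
inductive SREMO.Derives {U R : Type*} :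
    SREMO U R → ℕ → List U → Finset ℕ → Val U R → Val U R → Prop
  | eps (off : ℕ) (v : Val U R) : Derives .eps off [] ∅ v v
  | cond {φ : Cond U R} {o : Bool} (off : ℕ) {u : U} {v : Val U R} :
      φ u v → Derives (.cond φ o) off [u] (if o then {off} else ∅) v v
  | condW {φ : Cond U R} {o : Bool} {r : R} (off : ℕ) {u : U} {v : Val U R} :
      φ u v →
      Derives (.condW φ o r) off [u] (if o then {off} else ∅) v (v.updateW {r} u)
  | plusL {e₁ e₂ : SREMO U R} {off : ℕ} {S : List U} {M : Finset ℕ}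
      {v v' : Val U R} :
      Derives e₁ off S M v v' → Derives (.plus e₁ e₂) off S M v v'
  | plusR {e₁ e₂ : SREMO U R} {off : ℕ} {S : List U} {M : Finset ℕ}
      {v v' : Val U R} :
      Derives e₂ off S M v v' → Derives (.plus e₁ e₂) off S M v v'
  | cat {e₁ e₂ : SREMO U R} {off : ℕ} {S₁ S₂ : List U} {M₁ M₂ M : Finset ℕ}
      {v v'' v' : Val U R} :
      MatchCat M₁ M₂ M → Derives e₁ off S₁ M₁ v v'' →
      Derives e₂ (off + S₁.length) S₂ M₂ v'' v' →
      Derives (.cat e₁ e₂) off (S₁ ++ S₂) M v v'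
  | starNil {e : SREMO U R} (off : ℕ) (v : Val U R) :
      Derives (.star e) off [] ∅ v v
  | starCons {e : SREMO U R} {off : ℕ} {S₁ S₂ : List U} {M₁ M₂ M : Finset ℕ}
      {v v'' v' : Val U R} :
      S₁ ≠ [] → MatchCat M₁ M₂ M → Derives e off S₁ M₁ v v'' →
      Derives (.star e) (off + S₁.length) S₂ M₂ v'' v' →
      Derives (.star e) off (S₁ ++ S₂) M v v'

/-- `Lang(e)`: the strings derivable from `e` starting with all registers empty. -/
def SREMO.Lang {U R : Type*} (e : SREMO U R) : Set (List U) :=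
  {S | ∃ (M : Finset ℕ) (v' : Val U R), e.Derives 1 S M Val.sharp v'}

/-- `Match(e, S)`: the matches of `e` on the string `S`. -/
def SREMO.Matches {U R : Type*} (e : SREMO U R) (S : List U) : Set (Finset ℕ) :=
  {M | ∃ v' : Val U R, e.Derives 1 S M Val.sharp v'}

/-- The window constraint: whenever `M ≠ ∅`, `max M - min M + 1 ≤ w`. -/
def WindowOK (M : Finset ℕ) (w : ℕ) : Prop :=
  ∀ h : M.Nonempty, M.max' h - M.min' h + 1 ≤ w

/-- `Lang(e^[1..w])`: the language of the windowed SREMO `e^[1..w]`. -/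
def SREMO.WLang {U R : Type*} (e : SREMO U R) (w : ℕ) : Set (List U) :=
  {S | ∃ (M : Finset ℕ) (v' : Val U R),
    e.Derives 1 S M Val.sharp v' ∧ WindowOK M w}

/-- A transition of a symbolic register transducer: source, condition
(`none` denotes `ε`), write registers, target, output (`true` is `•`). -/
structure SRTTransition (U State Reg : Type*) where
  src : State
  cond : Option (Cond U Reg)
  wr : Set Reg
  tgt : State
  out : Bool

/-- A symbolic register transducer over `U`. -/
structure SRT (U : Type*) where
  State : Type
  Reg : Type
  stateFinite : Finite State
  regFinite : Finite Reg
  start : State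
  final : Set State
  trans : Set (SRTTransition U State Reg)
  transFinite : trans.Finite

/-- A configuration: position, current state, current valuation. -/
structure SRTConfig (U State Reg : Type*) where
  pos : ℕ
  state : State
  val : Val U Reg

/-- `c'` is a successor of `c` via the transition `δ`, while reading `S`. -/
def SRT.Step {U : Type*} (T : SRT U) (S : List U)
    (δ : SRTTransition U T.State T.Reg)
    (c c' : SRTConfig U T.State T.Reg) : Prop :=
  δ ∈ T.trans ∧ δ.src = c.state ∧ δ.tgt = c'.state ∧
    ((δ.cond = none ∧ c'.pos = c.pos ∧ c'.val = c.val) ∨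
      (∃ (φ : Cond U T.Reg) (u : U), δ.cond = some φ ∧
        S[c.pos - 1]? = some u ∧ φ u c.val ∧
        c'.pos = c.pos + 1 ∧ c'.val = c.val.updateW δ.wr u))

/-- The positions marked when a transition `δ` is taken at position `j`:
`{j}` if `δ` is a non-ε transition with output `•`, and `∅` otherwise. -/
def SRTTransition.mark {U State Reg : Type*} (δ : SRTTransition U State Reg)
    (j : ℕ) : Finset ℕ :=
  match δ.cond, δ.out with
  | some _, true => {j}
  | _, _ => ∅

/-- A run of `T` over `S` from configuration `c` to configuration `c'`,
via the list of transitions `δs`, producing the match `M`. -/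
inductive SRT.Run {U : Type*} (T : SRT U) (S : List U) :
    SRTConfig U T.State T.Reg → List (SRTTransition U T.State T.Reg) →
      Finset ℕ → SRTConfig U T.State T.Reg → Prop
  | nil (c : SRTConfig U T.State T.Reg) : Run T S c [] ∅ c
  | cons {c c' c'' : SRTConfig U T.State T.Reg}
      {δ : SRTTransition U T.State T.Reg}
      {δs : List (SRTTransition U T.State T.Reg)} {M : Finset ℕ} :
      T.Step S δ c c' → Run T S c' δs M c'' →
      Run T S c (δ :: δs) (δ.mark c.pos ∪ M) c''

/-- The initial configuration `[1, q_s, ♯]`. -/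
def SRT.init {U : Type*} (T : SRT U) : SRTConfig U T.State T.Reg :=
  ⟨1, T.start, Val.sharp⟩

/-- `T` has an accepting run over `S` with match `M`: a run starting at
`[1, q_s, ♯]`, ending at position `|S| + 1` in a final state, whose last
transition has output `•`. -/
def SRT.AccMatch {U : Type*} (T : SRT U) (S : List U) (M : Finset ℕ) : Prop :=
  ∃ (δs : List (SRTTransition U T.State T.Reg)) (q : T.State)
    (v : Val U T.Reg) (δlast : SRTTransition U T.State T.Reg),
    T.Run S T.init δs M ⟨S.length + 1, q, v⟩ ∧ q ∈ T.final ∧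
      δs.getLast? = some δlast ∧ δlast.out = true

/-- `Match(T, S)`: the matches of the accepting runs of `T` over `S`. -/
def SRT.MatchSet {U : Type*} (T : SRT U) (S : List U) : Set (Finset ℕ) :=
  {M | T.AccMatch S M}

/-- `Lang(T)`: the strings over which `T` has an accepting run. -/
def SRT.Lang {U : Type*} (T : SRT U) : Set (List U) :=
  {S | ∃ M : Finset ℕ, T.AccMatch S M}

/-- `Lang_oa(T)`: the output-agnostic language of `T` (outputs ignored). -/
def SRT.LangOA {U : Type*} (T : SRT U) : Set (List U) :=
  {S | ∃ (δs : List (SRTTransition U T.State T.Reg)) (M : Finset ℕ)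
      (q : T.State) (v : Val U T.Reg),
      T.Run S T.init δs M ⟨S.length + 1, q, v⟩ ∧ q ∈ T.final}

/-- `T` has no ε-transitions. -/
def SRT.NoEps {U : Type*} (T : SRT U) : Prop :=
  ∀ δ ∈ T.trans, δ.cond ≠ none

/-- `T` is deterministic: it has no ε-transitions and, for every state, every
element and every valuation, at most one transition from that state has a
condition satisfied by them. -/
def SRT.Deterministic {U : Type*} (T : SRT U) : Prop :=
  T.NoEps ∧
    ∀ δ₁ ∈ T.trans, ∀ δ₂ ∈ T.trans,
      ∀ (φ₁ φ₂ : Cond U T.Reg) (u : U) (v : Val U T.Reg),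
        δ₁.src = δ₂.src → δ₁.cond = some φ₁ → δ₂.cond = some φ₂ →
          φ₁ u v → φ₂ u v → δ₁ = δ₂

/-- `T` is complete: for every state, element and valuation, at least one
transition from that state has a condition satisfied by them (together with
determinism this gives exactly one). -/
def SRT.Complete {U : Type*} (T : SRT U) : Prop :=
  ∀ (q : T.State) (u : U) (v : Val U T.Reg),
    ∃ δ ∈ T.trans, δ.src = q ∧ ∃ φ : Cond U T.Reg, δ.cond = some φ ∧ φ u v

/-- Iterated match concatenation: `MatchCatList [M₁, …, Mₙ] M` states that
`M = M₁ · M₂ ⋯ Mₙ`. -/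
inductive MatchCatList : List (Finset ℕ) → Finset ℕ → Prop
  | nil : MatchCatList [] ∅
  | cons {M₁ : Finset ℕ} {Ms : List (Finset ℕ)} {M' M : Finset ℕ} :
      MatchCatList Ms M' → MatchCat M₁ M' M → MatchCatList (M₁ :: Ms) M

theorem Val.updateW_empty {U R : Type*} (v : Val U R) (u : U) : v.updateW ∅ u = v := by
  funext r
  simp [Val.updateW]

theorem Val.updateW_comp {U R R' : Type*} (v : Val U R) (W : Set R) (u : U) (f : R' → R) :
    v.updateW W u ∘ f = Val.updateW (v ∘ f) (f ⁻¹' W) u :=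
  rfl

namespace SREMO

variable {U R : Type*}

theorem Derives.mem_bounds {e : SREMO U R} {off : ℕ} {S : List U} {M : Finset ℕ} {v v' : Val U R}
    (h : e.Derives off S M v v') : ∀ i ∈ M, off ≤ i ∧ i < off + S.length := by
  induction h with
  | eps | starNil => simp
  | @cond _ o | @condW _ o => cases o <;> simp
  | plusL _ ih | plusR _ ih => exact ih
  | cat hM _ _ ih₁ ih₂ | starCons _ hM _ _ ih₁ ih₂ =>
    intro i hi
    rw [hM.2.1, Finset.mem_union] at hi
    rw [List.length_append]
    rcases hi with hi | hi
    · have := ih₁ i hi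
      omega
    · have := ih₂ i hi
      omega

theorem Derives.val_eq_of_nil {e : SREMO U R} {off : ℕ} {S : List U} {M : Finset ℕ}
    {v v' : Val U R} (h : e.Derives off S M v v') : S = [] → v' = v := by
  induction h with
  | eps | starNil => simp
  | cond | condW => simp
  | plusL _ ih | plusR _ ih => exact ih
  | cat _ _ _ ih₁ ih₂ =>
    intro hS
    rw [List.append_eq_nil_iff] at hS
    rw [ih₂ hS.2, ih₁ hS.1]
  | starCons hne => simp [hne]

theorem Derives.matchCat {e₁ e₂ : SREMO U R} {off : ℕ} {S₁ S₂ : List U} {M₁ M₂ : Finset ℕ}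
    {v₁ v₁' v₂ v₂' : Val U R} (h₁ : e₁.Derives off S₁ M₁ v₁ v₁')
    (h₂ : e₂.Derives (off + S₁.length) S₂ M₂ v₂ v₂') : MatchCat M₁ M₂ (M₁ ∪ M₂) := by
  have hlt : ∀ i ∈ M₁, ∀ j ∈ M₂, i < j := fun i hi j hj =>
    (h₁.mem_bounds i hi).2.trans_le (h₂.mem_bounds j hj).1
  exact ⟨Finset.disjoint_left.2 fun i h h' => lt_irrefl i (hlt i h i h'), rfl, hlt⟩

/-- Transition labels: `none` is a silent move, and `some (φ, W, o)` reads an element satisfying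
`φ`, writes it to the registers in `W` and outputs `o`. -/
abbrev Label (U R : Type*) := Option (Cond U R × Set R × Bool)

/-- `l.Act off S M v v'`: a move labelled `l` at position `off` reads `S`, marks `M`, and changes
the valuation from `v` to `v'`. -/
inductive Label.Act : Label U R → ℕ → List U → Finset ℕ → Val U R → Val U R → Prop
  | silent (off : ℕ) (v : Val U R) : Act none off [] ∅ v v
  | read {φ : Cond U R} {W : Set R} {o : Bool} (off : ℕ) {u : U} {v : Val U R} :
      φ u v → Act (some (φ, W, o)) off [u] (if o then {off} else ∅) v (v.updateW W u)

/-- The labelled moves between expressions, in the style of Antimirov's partial derivatives. -/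
def next : SREMO U R → Set (Label U R × SREMO U R)
  | empty => ∅
  | eps => ∅
  | cond φ o => {(some (φ, ∅, o), eps)}
  | condW φ o r => {(some (φ, {r}, o), eps)}
  | plus e₁ e₂ => {(none, e₁), (none, e₂)}
  | cat e₁ e₂ => (fun p => (p.1, cat p.2 e₂)) '' e₁.next ∪ {p | e₁ = eps ∧ p = (none, e₂)}
  | star e => {(none, eps), (none, cat e (star e))}

/-- A finite set of expressions containing `e` and closed under `next`. -/
def reach : SREMO U R → Set (SREMO U R)
  | empty => {empty}
  | eps => {eps}
  | cond φ o => {cond φ o, eps}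
  | condW φ o r => {condW φ o r, eps}
  | plus e₁ e₂ => insert (plus e₁ e₂) (e₁.reach ∪ e₂.reach)
  | cat e₁ e₂ => (fun x => cat x e₂) '' e₁.reach ∪ e₂.reach
  | star e => {star e, eps} ∪ (fun x => cat x (star e)) '' e.reach

theorem finite_next (e : SREMO U R) : e.next.Finite := by
  induction e with
  | cat e₁ e₂ ih₁ _ =>
    exact (ih₁.image _).union ((Set.finite_singleton (none, e₂)).subset fun p hp => hp.2)
  | _ => simp [next]

theorem finite_reach (e : SREMO U R) : e.reach.Finite := by
  induction e with
  | plus _ _ ih₁ ih₂ => exact (ih₁.union ih₂).insert _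
  | cat _ _ ih₁ ih₂ => exact (ih₁.image _).union ih₂
  | star _ ih => exact (Set.toFinite _).union (ih.image _)
  | _ => simp [reach]

theorem mem_reach_self (e : SREMO U R) : e ∈ e.reach := by
  induction e with
  | cat _ _ ih₁ _ => exact Or.inl ⟨_, ih₁, rfl⟩
  | _ => simp [reach]

theorem mem_reach_of_mem_next {e x y : SREMO U R} {l : Label U R} (hx : x ∈ e.reach)
    (h : (l, y) ∈ x.next) : y ∈ e.reach := by
  induction e generalizing x y l with
  | empty | eps =>
    obtain rfl := hx
    exact h.elim
  | cond | condW =>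
    rcases hx with rfl | rfl
    · exact Or.inr (Prod.mk.inj h).2
    · exact h.elim
  | plus e₁ e₂ ih₁ ih₂ =>
    rcases hx with rfl | hx | hx
    · rcases h with h | h
      · obtain ⟨-, rfl⟩ := Prod.mk.inj h
        exact Or.inr (Or.inl (mem_reach_self _))
      · obtain ⟨-, rfl⟩ := Prod.mk.inj h
        exact Or.inr (Or.inr (mem_reach_self _))
    · exact Or.inr (Or.inl (ih₁ hx h))
    · exact Or.inr (Or.inr (ih₂ hx h))
  | cat e₁ e₂ ih₁ ih₂ =>
    rcases hx with ⟨x, hx, rfl⟩ | hx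
    · rcases h with ⟨p, hp, h⟩ | ⟨-, h⟩
      · obtain ⟨-, rfl⟩ := Prod.mk.inj h
        exact Or.inl ⟨_, ih₁ hx hp, rfl⟩
      · obtain ⟨-, rfl⟩ := Prod.mk.inj h
        exact Or.inr (mem_reach_self _)
    · exact Or.inr (ih₂ hx h)
  | star e ih =>
    rcases hx with (rfl | rfl) | ⟨x, hx, rfl⟩
    · rcases h with h | h
      · obtain ⟨-, rfl⟩ := Prod.mk.inj h
        exact Or.inl (Or.inr rfl)
      · obtain ⟨-, rfl⟩ := Prod.mk.inj h
        exact Or.inr ⟨_, mem_reach_self _, rfl⟩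
    · exact h.elim
    · rcases h with ⟨p, hp, h⟩ | ⟨-, h⟩
      · obtain ⟨-, rfl⟩ := Prod.mk.inj h
        exact Or.inr ⟨_, ih hx hp, rfl⟩
      · obtain ⟨-, rfl⟩ := Prod.mk.inj h
        exact Or.inl (Or.inl rfl)

/-- `e.Evaluates off S M v v'`: a sequence of moves from `e` to `ε` reads `S`, marks `M`, and
changes the valuation from `v` to `v'`. -/
inductive Evaluates : SREMO U R → ℕ → List U → Finset ℕ → Val U R → Val U R → Prop
  | nil (off : ℕ) (v : Val U R) : Evaluates eps off [] ∅ v v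
  | step {e e' : SREMO U R} {l : Label U R} {off : ℕ} {S₀ S : List U} {M₀ M : Finset ℕ}
      {v v₁ v' : Val U R} :
      (l, e') ∈ e.next → l.Act off S₀ M₀ v v₁ → Evaluates e' (off + S₀.length) S M v₁ v' →
      Evaluates e off (S₀ ++ S) (M₀ ∪ M) v v'

theorem Evaluates.silent {e e' : SREMO U R} {off : ℕ} {S : List U} {M : Finset ℕ} {v v' : Val U R}
    (he : (none, e') ∈ e.next) (h : e'.Evaluates off S M v v') : e.Evaluates off S M v v' := by
  simpa using Evaluates.step he (.silent off v) h

theorem Evaluates.cat {e₁ e₂ : SREMO U R} {off : ℕ} {S₁ S₂ : List U} {M₁ M₂ : Finset ℕ}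
    {v v'' v' : Val U R} (h₁ : e₁.Evaluates off S₁ M₁ v v'')
    (h₂ : e₂.Evaluates (off + S₁.length) S₂ M₂ v'' v') :
    (SREMO.cat e₁ e₂).Evaluates off (S₁ ++ S₂) (M₁ ∪ M₂) v v' := by
  induction h₁ with
  | nil =>
    simpa using Evaluates.silent (e := SREMO.cat eps e₂) (Or.inr ⟨rfl, rfl⟩) h₂
  | step he ha _ ih =>
    rw [List.append_assoc, Finset.union_assoc]
    refine .step (Or.inl ⟨_, he, rfl⟩) ha (ih ?_)
    rwa [List.length_append, ← Nat.add_assoc] at h₂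

theorem Derives.evaluates {e : SREMO U R} {off : ℕ} {S : List U} {M : Finset ℕ} {v v' : Val U R}
    (h : e.Derives off S M v v') : e.Evaluates off S M v v' := by
  induction h with
  | eps off v => exact .nil off v
  | cond off hφ =>
    simpa [Val.updateW_empty] using
      Evaluates.step (e := SREMO.cond _ _) rfl (.read off hφ) (.nil _ _)
  | condW off hφ =>
    simpa using Evaluates.step (e := SREMO.condW _ _ _) rfl (.read off hφ) (.nil _ _)
  | plusL _ ih => exact .silent (Or.inl rfl) ih
  | plusR _ ih => exact .silent (Or.inr rfl) ih
  | cat hM _ _ ih₁ ih₂ =>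
    rw [hM.2.1]
    exact ih₁.cat ih₂
  | starNil off v => exact .silent (Or.inl rfl) (.nil off v)
  | starCons _ hM _ _ ih₁ ih₂ =>
    rw [hM.2.1]
    exact .silent (Or.inr rfl) (ih₁.cat ih₂)

theorem Derives.of_mem_next {e e' : SREMO U R} {l : Label U R} {off : ℕ} {S₀ S : List U}
    {M₀ M : Finset ℕ} {v v₁ v' : Val U R} (he : (l, e') ∈ e.next) (ha : l.Act off S₀ M₀ v v₁)
    (h : e'.Derives (off + S₀.length) S M v₁ v') :
    e.Derives off (S₀ ++ S) (M₀ ∪ M) v v' := by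
  induction e generalizing e' l S M v' with
  | empty | eps => exact he.elim
  | cond =>
    obtain ⟨rfl, rfl⟩ := Prod.mk.inj he
    cases ha with | read _ hφ =>
    cases h
    simpa [Val.updateW_empty] using Derives.cond off hφ
  | condW =>
    obtain ⟨rfl, rfl⟩ := Prod.mk.inj he
    cases ha with | read _ hφ =>
    cases h
    simpa using Derives.condW off hφ
  | plus =>
    rcases he with he | he
    · obtain ⟨rfl, rfl⟩ := Prod.mk.inj he
      cases ha
      simpa using Derives.plusL h
    · obtain ⟨rfl, rfl⟩ := Prod.mk.inj he
      cases ha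
      simpa using Derives.plusR h
  | cat e₁ e₂ ih₁ _ =>
    rcases he with ⟨⟨l, x⟩, hx, he⟩ | ⟨rfl, he⟩
    · obtain ⟨rfl, rfl⟩ := Prod.mk.inj he
      cases h with | cat hM h₁ h₂ =>
      have h₁' := ih₁ hx ha h₁
      rw [Nat.add_assoc, ← List.length_append] at h₂
      rw [hM.2.1, ← List.append_assoc, ← Finset.union_assoc]
      exact .cat (h₁'.matchCat h₂) h₁' h₂
    · obtain ⟨rfl, rfl⟩ := Prod.mk.inj he
      cases ha
      have h₀ := Derives.eps off v
      exact .cat (h₀.matchCat h) h₀ h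
  | star e _ =>
    rcases he with he | he
    · obtain ⟨rfl, rfl⟩ := Prod.mk.inj he
      cases ha
      cases h
      exact .starNil off v
    · obtain ⟨rfl, rfl⟩ := Prod.mk.inj he
      cases ha
      cases h with | @cat _ _ _ S₁ _ M₁ _ _ _ _ _ hM h₁ h₂ =>
      rw [Finset.empty_union, List.nil_append]
      by_cases hS : S₁ = []
      · subst hS
        obtain rfl := h₁.val_eq_of_nil rfl
        have hM₁ : M₁ = ∅ := Finset.eq_empty_of_forall_notMem fun i hi => by
          have := h₁.mem_bounds i hi
          simp only [List.length_nil] at this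
          omega
        simpa [hM.2.1, hM₁] using h₂
      · exact .starCons hS hM h₁ h₂

theorem evaluates_iff_derives {e : SREMO U R} {off : ℕ} {S : List U} {M : Finset ℕ}
    {v v' : Val U R} : e.Evaluates off S M v v' ↔ e.Derives off S M v v' := by
  refine ⟨fun h => ?_, Derives.evaluates⟩
  induction h with
  | nil off v => exact .eps off v
  | step he ha _ ih => exact ih.of_mem_next he ha

variable {Q Reg : Type}

/-- The transition from `q` to `q'` with label `l`, whose registers are renamed along `ρ`. -/
def Label.toTransition (l : Label U R) (ρ : R ≃ Reg) (q q' : Q) :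
    SRTTransition U (Option Q) Reg where
  src := some q
  cond := l.map fun p u v => p.1 u (v ∘ ρ)
  wr := ρ.symm ⁻¹' (l.elim ∅ fun p => p.2.1)
  tgt := some q'
  out := l.elim false fun p => p.2.2

/-- The `ε`-transition with output `•` from `q` to the final state. -/
def accepting (U Reg : Type*) (q : Q) : SRTTransition U (Option Q) Reg where
  src := some q
  cond := none
  wr := ∅
  tgt := none
  out := true

/-- The transducer whose states are names, given by `d`, for expressions, together with a single
final state `none`. -/
abbrev toSRT [Finite Q] [Finite Reg] (d : Q → SREMO U R) (ρ : R ≃ Reg) (q₀ : Q) : SRT U where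
  State := Option Q
  Reg := Reg
  stateFinite := inferInstance
  regFinite := inferInstance
  start := some q₀
  final := {none}
  trans := (⋃ q, ⋃ q', (fun p => p.1.toTransition ρ q q') '' {p ∈ (d q).next | p.2 = d q'}) ∪
    accepting U Reg '' {q | d q = eps}
  transFinite := by
    refine .union (Set.finite_iUnion fun q => Set.finite_iUnion fun q' => ?_)
      ((Set.toFinite _).image _)
    exact ((finite_next _).subset (Set.sep_subset _ _)).image _

variable [Finite Q] [Finite Reg] {d : Q → SREMO U R} {ρ : R ≃ Reg} {q₀ : Q}

theorem mem_trans_toSRT {δ : SRTTransition U (Option Q) Reg} :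
    δ ∈ (toSRT d ρ q₀).trans ↔
      (∃ q q' l, (l, d q') ∈ (d q).next ∧ l.toTransition ρ q q' = δ) ∨
        ∃ q, d q = eps ∧ accepting U Reg q = δ := by
  constructor
  · rintro (h | h)
    · simp only [Set.mem_iUnion] at h
      obtain ⟨q, q', ⟨l, _⟩, ⟨hl, rfl⟩, h⟩ := h
      exact Or.inl ⟨q, q', l, hl, h⟩
    · exact Or.inr h
  · rintro (⟨q, q', l, hl, h⟩ | h)
    · refine Or.inl ?_
      simp only [Set.mem_iUnion]
      exact ⟨q, q', (l, d q'), ⟨hl, rfl⟩, h⟩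
    · exact Or.inr h

theorem run_toSRT_none {S : List U} {c c' : SRTConfig U (toSRT d ρ q₀).State (toSRT d ρ q₀).Reg}
    {δs : List (SRTTransition U (toSRT d ρ q₀).State (toSRT d ρ q₀).Reg)}
    {M : Finset ℕ}
    (h : (toSRT d ρ q₀).Run S c δs M c') (hc : c.state = none) : M = ∅ ∧ c' = c := by
  cases h with
  | nil => exact ⟨rfl, rfl⟩
  | cons hs _ =>
    obtain ⟨hδ, hsrc, -⟩ := hs
    rcases mem_trans_toSRT.1 hδ with ⟨q, q', l, -, rfl⟩ | ⟨q, -, rfl⟩ <;>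
      exact absurd (hsrc.trans hc) (Option.some_ne_none q)

theorem evaluates_of_run_toSRT {S : List U}
    {c c' : SRTConfig U (toSRT d ρ q₀).State (toSRT d ρ q₀).Reg}
    {δs : List (SRTTransition U (toSRT d ρ q₀).State (toSRT d ρ q₀).Reg)}
    {M : Finset ℕ}
    (h : (toSRT d ρ q₀).Run S c δs M c') (hc' : c'.state = none) (hpos : c'.pos = S.length + 1) :
    ∀ {q : Q} {P S' : List U}, c.state = some q → S = P ++ S' → c.pos = P.length + 1 →
      (d q).Evaluates c.pos S' M (c.val ∘ ρ) (c'.val ∘ ρ) := by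
  induction h with
  | nil c => exact fun hq => absurd (hc'.symm.trans hq).symm (Option.some_ne_none _)
  | @cons c c₁ c' δ δs M hs hr ih =>
    intro q P S' hq hS hP
    obtain ⟨hδ, hsrc, htgt, hact⟩ := hs
    rw [hq] at hsrc
    rcases mem_trans_toSRT.1 hδ with ⟨q₁, q', l, hl, rfl⟩ | ⟨q₁, hq₁, rfl⟩
    · obtain rfl : q₁ = q := Option.some.inj hsrc
      rcases hact with ⟨hn, hp, hv⟩ | ⟨φ, u, hφ, hu, hφv, hp, hv⟩
      · obtain rfl : l = none := by simpa [Label.toTransition] using hn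
        have := ih hc' hpos htgt.symm hS (hp.trans hP)
        rw [hp, hv] at this
        simpa [SRTTransition.mark, Label.toTransition] using this.silent hl
      · obtain ⟨p, rfl, rfl⟩ := Option.map_eq_some_iff.1 hφ
        obtain ⟨ψ, W, o⟩ := p
        rw [hS, hP, Nat.add_sub_cancel, List.getElem?_append_right le_rfl, Nat.sub_self] at hu
        obtain ⟨S'', rfl⟩ : ∃ S'', S' = u :: S'' := by
          cases S' with
          | nil => simp at hu
          | cons a t => exact ⟨t, by simpa using hu⟩
        have := ih hc' hpos htgt.symm (P := P ++ [u]) (S' := S'') (by simp [hS]) (by simp [hp, hP])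
        rw [hp, hv] at this
        have hm : (Label.toTransition (some (ψ, W, o)) ρ q₁ q').mark c.pos =
            if o then {c.pos} else ∅ := by
          cases o <;> rfl
        have hW : ρ ⁻¹' (Label.toTransition (some (ψ, W, o)) ρ q₁ q').wr = W := by
          simp [Label.toTransition, ← Set.preimage_comp]
        rw [Val.updateW_comp, hW] at this
        rw [hm]
        exact .step (S₀ := [u]) hl (.read c.pos hφv) this
    · obtain rfl : q₁ = q := Option.some.inj hsrc
      obtain ⟨rfl, rfl⟩ := run_toSRT_none hr htgt.symm
      obtain ⟨-, hp, hv⟩ := hact.resolve_right fun ⟨_, _, h, _⟩ => Option.some_ne_none _ h.symm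
      have hS' : S' = [] := by
        rw [hp, hP, hS, List.length_append] at hpos
        exact List.length_eq_zero_iff.1 (by omega)
      rw [hq₁, hS', hv]
      exact .nil _ _

theorem exists_run_toSRT_of_evaluates
    (hd : ∀ q l x, (l, x) ∈ (d q).next → x ∈ Set.range d) {x : SREMO U R} {off : ℕ}
    {S' : List U} {M : Finset ℕ} {v v' : Val U R} (h : x.Evaluates off S' M v v') :
    ∀ {q : Q} {P : List U}, d q = x → off = P.length + 1 →
      ∃ δs δlast, (toSRT d ρ q₀).Run (P ++ S') ⟨off, some q, v ∘ ρ.symm⟩ δs M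
          ⟨(P ++ S').length + 1, none, v' ∘ ρ.symm⟩ ∧
        δs.getLast? = some δlast ∧ δlast.out = true := by
  induction h with
  | nil off v =>
    rintro q P hq rfl
    refine ⟨[accepting U Reg q], accepting U Reg q, ?_, rfl, rfl⟩
    rw [List.append_nil]
    exact .cons (c' := ⟨P.length + 1, none, v ∘ ρ.symm⟩) (M := ∅)
      ⟨mem_trans_toSRT.2 (Or.inr ⟨q, hq, rfl⟩), rfl, rfl, Or.inl ⟨rfl, rfl, rfl⟩⟩ (.nil _)
  | @step e e' l off S₀ S' M₀ M v v₁ v' he ha _ ih =>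
    rintro q P rfl rfl
    obtain ⟨q', rfl⟩ := hd q l e' he
    have hδ := (mem_trans_toSRT (ρ := ρ) (q₀ := q₀)).2 (Or.inl ⟨q, q', l, he, rfl⟩)
    obtain ⟨δs, δlast, hr, hlast, hout⟩ :=
      ih (q := q') (P := P ++ S₀) rfl (by rw [List.length_append]; omega)
    rw [List.append_assoc] at hr
    refine ⟨l.toTransition ρ q q' :: δs, δlast, ?_, by simp [List.getLast?_cons, hlast], hout⟩
    cases ha with
    | silent =>
      exact .cons (c' := ⟨P.length + 1, some q', v ∘ ρ.symm⟩)
        ⟨hδ, rfl, rfl, Or.inl ⟨rfl, rfl, rfl⟩⟩ hr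
    | @read φ W o _ u _ hφ =>
      have hm : (if o then {P.length + 1} else ∅) =
          (Label.toTransition (some (φ, W, o)) ρ q q').mark (P.length + 1) := by
        cases o <;> rfl
      rw [hm]
      refine .cons ⟨hδ, rfl, rfl, Or.inr ⟨_, u, rfl, by simp, ?_, rfl, rfl⟩⟩ hr
      simpa [Function.comp_assoc] using hφ

theorem accMatch_toSRT_iff (hd : ∀ q l x, (l, x) ∈ (d q).next → x ∈ Set.range d) (S : List U)
    (M : Finset ℕ) : (toSRT d ρ q₀).AccMatch S M ↔ M ∈ (d q₀).Matches S := by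
  constructor
  · rintro ⟨δs, q, v, δlast, hr, hq, -⟩
    exact ⟨v ∘ ρ, evaluates_iff_derives.1 (evaluates_of_run_toSRT hr hq rfl (P := []) rfl rfl rfl)⟩
  · rintro ⟨v', h⟩
    obtain ⟨δs, δlast, hr, hlast, hout⟩ :=
      exists_run_toSRT_of_evaluates (ρ := ρ) (q₀ := q₀) hd h.evaluates (P := []) rfl rfl
    exact ⟨δs, none, _, δlast, hr, rfl, hlast, hout⟩

end SREMO

/-- Every SREMO over `(U, R)` has an equivalent SRT over `U`:
one with the same language and the same matches on every string. -/
theorem sremo_to_srt {U R : Type*} [Nonempty U] [Finite R] (e : SREMO U R) :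
    ∃ T : SRT U, T.Lang = e.Lang ∧ ∀ S : List U, T.MatchSet S = e.Matches S := by
  obtain ⟨m, ⟨ρ⟩⟩ := Finite.exists_equiv_fin R
  have := e.finite_reach.to_subtype
  obtain ⟨n, ⟨σ⟩⟩ := Finite.exists_equiv_fin e.reach
  let d : Fin n → SREMO U R := fun i => σ.symm i
  let q₀ : Fin n := σ ⟨e, e.mem_reach_self⟩
  have hq₀ : d q₀ = e := by simp [d, q₀]
  have hd : ∀ q l x, (l, x) ∈ (d q).next → x ∈ Set.range d := fun q l x h =>
    ⟨σ ⟨x, SREMO.mem_reach_of_mem_next (σ.symm q).2 h⟩, by simp [d]⟩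
  have key : ∀ S M, (SREMO.toSRT d ρ q₀).AccMatch S M ↔ M ∈ e.Matches S := fun S M => by
    rw [SREMO.accMatch_toSRT_iff hd, hq₀]
  exact ⟨SREMO.toSRT d ρ q₀, Set.ext fun S => exists_congr (key S), fun S => Set.ext (key S)⟩
end

section
/- SRT are closed under concatenation: for all SRT T₁ and T₂ over U there exists an SRT T over U such that for every string S over U and every match M, M ∈ Match(T,S) iff there exist a decomposition S = S₁·S₂ and matches M₁ ∈ Match(T₁,S₁) and M₂ ∈ Match(T₂,S₂) — where the positions in Match(T₂,S₂) are shifted by |S₁| so as to refer to absolute positions in S — such that M = M₁·M₂. -/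
open scoped Classical

namespace SRTTransition

/-- Transport a transition along a register map, with prescribed source and target. -/
def lift {U Q R Q' R' : Type*} (g : R → R') (s t : Q') (δ : SRTTransition U Q R) :
    SRTTransition U Q' R' :=
  ⟨s, δ.cond.map fun φ u w => φ u (w ∘ g), g '' δ.wr, t, δ.out⟩

/-- Taking the transition `δ` at position `p` with valuation `v` while reading `S` is possible and
leads to position `p'` and valuation `v'`. -/
def Advances {U Q R : Type*} (δ : SRTTransition U Q R) (S : List U)
    (p : ℕ) (v : Val U R) (p' : ℕ) (v' : Val U R) : Prop :=
  (δ.cond = none ∧ p' = p ∧ v' = v) ∨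
    ∃ (φ : Cond U R) (u : U), δ.cond = some φ ∧ S[p - 1]? = some u ∧ φ u v ∧
      p' = p + 1 ∧ v' = v.updateW δ.wr u

@[simp] theorem mark_lift {U Q R Q' R' : Type*} (g : R → R') (s t : Q')
    (δ : SRTTransition U Q R) (j : ℕ) : (δ.lift g s t).mark j = δ.mark j := by
  rcases δ with ⟨_, _ | φ, _, _, _ | _⟩ <;> rfl

theorem mark_add {U Q R : Type*} (δ : SRTTransition U Q R) (j k : ℕ) :
    δ.mark (j + k) = (δ.mark j).image (· + k) := by
  rcases δ with ⟨_, _ | φ, _, _, _ | _⟩ <;> simp [mark]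

theorem updateW_comp {U R R' : Type*} {g : R → R'} (hg : g.Injective) (w : Val U R')
    (W : Set R) (u : U) : w.updateW (g '' W) u ∘ g = Val.updateW (w ∘ g) W u := by
  funext r
  simp [Val.updateW, hg.mem_set_image]

theorem updateW_image_of_notMem_range {U R R' : Type*} {g : R → R'} (w : Val U R')
    (W : Set R) (u : U) {r : R'} (hr : r ∉ Set.range g) :
    w.updateW (g '' W) u r = w r :=
  if_neg fun h => hr (Set.image_subset_range g W h)

theorem Advances.lift {U Q R Q' R' : Type*} {g : R → R'} (hg : g.Injective) (s t : Q')
    {δ : SRTTransition U Q R} {S : List U} {p p' : ℕ} {v' : Val U R} {w : Val U R'}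
    (h : δ.Advances S p (w ∘ g) p' v') :
    ∃ w', (δ.lift g s t).Advances S p w p' w' ∧ w' ∘ g = v' := by
  rcases h with ⟨hc, rfl, rfl⟩ | ⟨φ, u, hc, hu, hφ, rfl, rfl⟩
  · exact ⟨w, .inl ⟨by simp [SRTTransition.lift, hc], rfl, rfl⟩, rfl⟩
  · exact ⟨_, .inr ⟨fun u w => φ u (w ∘ g), u, by simp [SRTTransition.lift, hc], hu, hφ, rfl,
      rfl⟩, updateW_comp hg _ _ _⟩

theorem Advances.of_lift {U Q R Q' R' : Type*} {g : R → R'} (hg : g.Injective) {s t : Q'}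
    {δ : SRTTransition U Q R} {S : List U} {p p' : ℕ} {w w' : Val U R'}
    (h : (δ.lift g s t).Advances S p w p' w') : δ.Advances S p (w ∘ g) p' (w' ∘ g) := by
  rcases h with ⟨hc, rfl, rfl⟩ | ⟨φ, u, hc, hu, hφ, rfl, rfl⟩
  · exact .inl ⟨by simpa [SRTTransition.lift] using hc, rfl, rfl⟩
  · obtain ⟨ψ, hψ, rfl⟩ := Option.map_eq_some_iff.1 hc
    exact .inr ⟨ψ, u, hψ, hu, hφ, rfl, updateW_comp hg _ _ _⟩

theorem Advances.val_eq_of_notMem_range {U Q R Q' R' : Type*} {g : R → R'} {s t : Q'}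
    {δ : SRTTransition U Q R} {S : List U} {p p' : ℕ} {w w' : Val U R'}
    (h : (δ.lift g s t).Advances S p w p' w') {r : R'} (hr : r ∉ Set.range g) :
    w' r = w r := by
  rcases h with ⟨-, -, rfl⟩ | ⟨_, u, -, -, -, -, rfl⟩
  · rfl
  · exact updateW_image_of_notMem_range w _ u hr

/-- The output of the last transition of a list, or `b` if the list is empty. -/
def lastOut {U Q R : Type*} (b : Bool) (δs : List (SRTTransition U Q R)) : Bool :=
  δs.foldl (fun _ δ => δ.out) b

@[simp] theorem lastOut_nil {U Q R : Type*} (b : Bool) :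
    lastOut b ([] : List (SRTTransition U Q R)) = b := rfl

@[simp] theorem lastOut_cons {U Q R : Type*} (b : Bool) (δ : SRTTransition U Q R)
    (δs : List (SRTTransition U Q R)) : lastOut b (δ :: δs) = lastOut δ.out δs := rfl

@[simp] theorem lastOut_append {U Q R : Type*} (b : Bool) (δs δs' : List (SRTTransition U Q R)) :
    lastOut b (δs ++ δs') = lastOut (lastOut b δs) δs' := List.foldl_append

theorem lastOut_false_eq_true_iff {U Q R : Type*} {δs : List (SRTTransition U Q R)} :
    lastOut false δs = true ↔ ∃ δ, δs.getLast? = some δ ∧ δ.out = true := by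
  induction δs using List.reverseRecOn with
  | nil => simp
  | append_singleton l a _ => simp

end SRTTransition

namespace SRT

open SRTTransition

theorem accMatch_iff {U : Type*} {T : SRT U} {S : List U} {M : Finset ℕ} :
    T.AccMatch S M ↔ ∃ δs q v, T.Run S T.init δs M ⟨S.length + 1, q, v⟩ ∧ q ∈ T.final ∧
      lastOut false δs = true := by
  simp only [AccMatch, lastOut_false_eq_true_iff, exists_and_left]

theorem Run.append {U : Type*} {T : SRT U} {S : List U} {c c' c'' : SRTConfig U T.State T.Reg}
    {δs δs' : List (SRTTransition U T.State T.Reg)} {M M' : Finset ℕ}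
    (h : T.Run S c δs M c') (h' : T.Run S c' δs' M' c'') :
    T.Run S c (δs ++ δs') (M ∪ M') c'' := by
  induction h with
  | nil => simpa using h'
  | cons hs _ ih => rw [Finset.union_assoc]; exact .cons hs (ih h')

theorem Step.pos_le {U : Type*} {T : SRT U} {S : List U} {c c' : SRTConfig U T.State T.Reg}
    {δ : SRTTransition U T.State T.Reg} (h : T.Step S δ c c') : c.pos ≤ c'.pos := by
  rcases h with ⟨-, -, -, ⟨-, h, -⟩ | ⟨_, _, -, -, -, h, -⟩⟩ <;> omega

theorem Step.mark_subset {U : Type*} {T : SRT U} {S : List U}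
    {c c' : SRTConfig U T.State T.Reg} {δ : SRTTransition U T.State T.Reg}
    (h : T.Step S δ c c') : δ.mark c.pos ⊆ Finset.Ico c.pos c'.pos := by
  rcases δ with ⟨_, _ | φ, _, _, _ | _⟩ <;> simp [mark]
  rcases h with ⟨-, -, -, ⟨h, -, -⟩ | ⟨_, _, -, -, -, h, -⟩⟩
  · cases h
  · omega

theorem Run.pos_le {U : Type*} {T : SRT U} {S : List U} {c c' : SRTConfig U T.State T.Reg}
    {δs : List (SRTTransition U T.State T.Reg)} {M : Finset ℕ} (h : T.Run S c δs M c') :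
    c.pos ≤ c'.pos := by
  induction h with
  | nil => rfl
  | cons hs _ ih => exact hs.pos_le.trans ih

theorem Run.match_subset {U : Type*} {T : SRT U} {S : List U} {c c' : SRTConfig U T.State T.Reg}
    {δs : List (SRTTransition U T.State T.Reg)} {M : Finset ℕ} (h : T.Run S c δs M c') :
    M ⊆ Finset.Ico c.pos c'.pos := by
  induction h with
  | nil => simp
  | cons hs hr ih =>
    exact Finset.union_subset
      (hs.mark_subset.trans (Finset.Ico_subset_Ico_right hr.pos_le))
      (ih.trans (Finset.Ico_subset_Ico_left hs.pos_le))

theorem Run.append_string {U : Type*} {T : SRT U} {S₁ : List U} (S₂ : List U)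
    {c c' : SRTConfig U T.State T.Reg} {δs : List (SRTTransition U T.State T.Reg)}
    {M : Finset ℕ} (h : T.Run S₁ c δs M c') : T.Run (S₁ ++ S₂) c δs M c' := by
  induction h with
  | nil c => exact .nil c
  | cons hs _ ih =>
    refine .cons ⟨hs.1, hs.2.1, hs.2.2.1, hs.2.2.2.imp_right ?_⟩ ih
    rintro ⟨φ, u, hφ, hu, h⟩
    exact ⟨φ, u, hφ, List.getElem?_append_left (List.getElem?_eq_some_iff.1 hu).1 ▸ hu, h⟩

theorem Run.of_append_string {U : Type*} {T : SRT U} {S₁ S₂ : List U}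
    {c c' : SRTConfig U T.State T.Reg} {δs : List (SRTTransition U T.State T.Reg)}
    {M : Finset ℕ} (h : T.Run (S₁ ++ S₂) c δs M c') (hc : 1 ≤ c.pos)
    (hc' : c'.pos ≤ S₁.length + 1) : T.Run S₁ c δs M c' := by
  induction h with
  | nil c => exact .nil c
  | cons hs hr ih =>
    refine .cons ⟨hs.1, hs.2.1, hs.2.2.1, hs.2.2.2.imp_right ?_⟩ (ih (hc.trans hs.pos_le) hc')
    rintro ⟨φ, u, hφ, hu, hv, hp, h⟩
    have := hr.pos_le
    rw [List.getElem?_append_left (by omega)] at hu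
    exact ⟨φ, u, hφ, hu, hv, hp, h⟩

theorem step_shift_iff {U : Type*} {T : SRT U} {S₁ S₂ : List U}
    {δ : SRTTransition U T.State T.Reg} {p p' : ℕ} {q q' : T.State} {v v' : Val U T.Reg}
    (hp : 1 ≤ p) :
    T.Step (S₁ ++ S₂) δ ⟨p + S₁.length, q, v⟩ ⟨p' + S₁.length, q', v'⟩ ↔
      T.Step S₂ δ ⟨p, q, v⟩ ⟨p', q', v'⟩ := by
  have h : (S₁ ++ S₂)[p + S₁.length - 1]? = S₂[p - 1]? := by
    rw [List.getElem?_append_right (by omega)]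
    congr 1
    omega
  have h' : p' + S₁.length = p + S₁.length + 1 ↔ p' = p + 1 := by omega
  simp only [Step, h, h', Nat.add_right_cancel_iff]

theorem Run.shift {U : Type*} {T : SRT U} (S₁ : List U) {S₂ : List U}
    {c c' : SRTConfig U T.State T.Reg} {δs : List (SRTTransition U T.State T.Reg)}
    {M : Finset ℕ} (h : T.Run S₂ c δs M c') (hc : 1 ≤ c.pos) :
    T.Run (S₁ ++ S₂) ⟨c.pos + S₁.length, c.state, c.val⟩ δs (M.image (· + S₁.length))
      ⟨c'.pos + S₁.length, c'.state, c'.val⟩ := by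
  induction h with
  | nil c => exact .nil _
  | cons hs hr ih =>
    rw [Finset.image_union, ← mark_add]
    exact .cons ((step_shift_iff hc).2 hs) (ih (hc.trans hs.pos_le))

theorem Run.of_shift {U : Type*} {T : SRT U} {S₁ S₂ : List U}
    {c c' : SRTConfig U T.State T.Reg} {δs : List (SRTTransition U T.State T.Reg)}
    {M : Finset ℕ} (h : T.Run (S₁ ++ S₂) c δs M c') (hc : S₁.length + 1 ≤ c.pos) :
    ∃ M', M = M'.image (· + S₁.length) ∧
      T.Run S₂ ⟨c.pos - S₁.length, c.state, c.val⟩ δs M'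
        ⟨c'.pos - S₁.length, c'.state, c'.val⟩ := by
  induction h with
  | nil c => exact ⟨∅, rfl, .nil _⟩
  | @cons c d _ δ _ _ hs hr ih =>
    have hcd := hs.pos_le
    obtain ⟨M', rfl, h⟩ := ih (hc.trans hcd)
    have e : c.pos - S₁.length + S₁.length = c.pos := by omega
    have e' : d.pos - S₁.length + S₁.length = d.pos := by omega
    refine ⟨δ.mark (c.pos - S₁.length) ∪ M', ?_, .cons ?_ h⟩
    · rw [Finset.image_union, ← mark_add, e]
    · rw [← step_shift_iff (S₁ := S₁) (by omega), e, e']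
      exact hs

section Concat

variable {U : Type*} (T₁ T₂ : SRT U)

/-- A transition of the first factor; the flag in the state records the last output. -/
def liftLeft (b : Bool) (δ : SRTTransition U T₁.State T₁.Reg) :
    SRTTransition U ((T₁.State × Bool) ⊕ T₂.State) (T₁.Reg ⊕ T₂.Reg) :=
  δ.lift Sum.inl (.inl (δ.src, b)) (.inl (δ.tgt, δ.out))

/-- A transition of the second factor. -/
def liftRight (δ : SRTTransition U T₂.State T₂.Reg) :
    SRTTransition U ((T₁.State × Bool) ⊕ T₂.State) (T₁.Reg ⊕ T₂.Reg) :=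
  δ.lift Sum.inr (.inr δ.src) (.inr δ.tgt)

/-- The `ε`-transition from a final state of the first factor, entered with output `•`, to the start
state of the second factor. -/
def bridge (q : T₁.State) :
    SRTTransition U ((T₁.State × Bool) ⊕ T₂.State) (T₁.Reg ⊕ T₂.Reg) :=
  ⟨.inl (q, true), none, ∅, .inr T₂.start, false⟩

/-- The concatenation of two transducers. -/
abbrev concat : SRT U where
  State := (T₁.State × Bool) ⊕ T₂.State
  Reg := T₁.Reg ⊕ T₂.Reg
  stateFinite := by
    have := T₁.stateFinite
    have := T₂.stateFinite
    infer_instance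
  regFinite := by
    have := T₁.regFinite
    have := T₂.regFinite
    infer_instance
  start := .inl (T₁.start, false)
  final := Sum.inr '' T₂.final
  trans := (liftLeft T₁ T₂ false '' T₁.trans ∪ liftLeft T₁ T₂ true '' T₁.trans) ∪
    (bridge T₁ T₂ '' T₁.final ∪ liftRight T₁ T₂ '' T₂.trans)
  transFinite := by
    have := T₁.stateFinite
    exact ((T₁.transFinite.image _).union (T₁.transFinite.image _)).union
      ((T₁.final.toFinite.image _).union (T₂.transFinite.image _))

variable {T₁ T₂}

theorem mem_trans_concat {δ : SRTTransition U ((T₁.State × Bool) ⊕ T₂.State) (T₁.Reg ⊕ T₂.Reg)} :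
    δ ∈ (concat T₁ T₂).trans ↔ (∃ b, ∃ δ₁ ∈ T₁.trans, liftLeft T₁ T₂ b δ₁ = δ) ∨
      (∃ q ∈ T₁.final, bridge T₁ T₂ q = δ) ∨ ∃ δ₂ ∈ T₂.trans, liftRight T₁ T₂ δ₂ = δ := by
  simp only [concat, Set.mem_union, Set.mem_image, Bool.exists_bool, or_assoc]

theorem Run.liftLeft {S : List U} {c c' : SRTConfig U T₁.State T₁.Reg}
    {δs : List (SRTTransition U T₁.State T₁.Reg)} {M : Finset ℕ} (h : T₁.Run S c δs M c')
    (b : Bool) (w : Val U (T₁.Reg ⊕ T₂.Reg)) (hw : w ∘ Sum.inl = c.val) :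
    ∃ δs' w', (concat T₁ T₂).Run S ⟨c.pos, .inl (c.state, b), w⟩ δs' M
        ⟨c'.pos, .inl (c'.state, lastOut b δs), w'⟩ ∧
      w' ∘ Sum.inl = c'.val ∧ w' ∘ Sum.inr = w ∘ Sum.inr := by
  induction h generalizing b w with
  | nil c => exact ⟨[], w, .nil _, hw, rfl⟩
  | @cons c d _ δ _ _ hs _ ih =>
    obtain ⟨hδ, hsrc, htgt, hadv⟩ := hs
    rw [← hw] at hadv
    obtain ⟨w₁, ha, hw₁⟩ := Advances.lift (Sum.inl_injective (β := T₂.Reg))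
      (Sum.inl (δ.src, b) : (T₁.State × Bool) ⊕ T₂.State) (.inl (δ.tgt, δ.out)) hadv
    obtain ⟨δs', w', hr, hl, hr'⟩ := ih δ.out w₁ hw₁
    refine ⟨SRT.liftLeft T₁ T₂ b δ :: δs', w', ?_, hl, hr'.trans ?_⟩
    · rw [← mark_lift (Sum.inl : T₁.Reg → T₁.Reg ⊕ T₂.Reg)
        (Sum.inl (δ.src, b) : (T₁.State × Bool) ⊕ T₂.State) (.inl (δ.tgt, δ.out)) δ c.pos]
      have hstep : (concat T₁ T₂).Step S (SRT.liftLeft T₁ T₂ b δ)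
          ⟨c.pos, .inl (c.state, b), w⟩ ⟨d.pos, .inl (d.state, δ.out), w₁⟩ :=
        ⟨mem_trans_concat.2 (.inl ⟨b, δ, hδ, rfl⟩), congrArg (fun q => Sum.inl (q, b)) hsrc,
          congrArg (fun q => Sum.inl (q, δ.out)) htgt, ha⟩
      exact .cons hstep hr
    · funext r
      exact ha.val_eq_of_notMem_range (by simp)

theorem Run.liftRight {S : List U} {c c' : SRTConfig U T₂.State T₂.Reg}
    {δs : List (SRTTransition U T₂.State T₂.Reg)} {M : Finset ℕ} (h : T₂.Run S c δs M c')
    (w : Val U (T₁.Reg ⊕ T₂.Reg)) (hw : w ∘ Sum.inr = c.val) :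
    ∃ δs' w', (concat T₁ T₂).Run S ⟨c.pos, .inr c.state, w⟩ δs' M ⟨c'.pos, .inr c'.state, w'⟩ ∧
      ∀ b, lastOut b δs' = lastOut b δs := by
  induction h generalizing w with
  | nil c => exact ⟨[], w, .nil _, fun _ => rfl⟩
  | @cons c d _ δ _ _ hs _ ih =>
    obtain ⟨hδ, hsrc, htgt, hadv⟩ := hs
    rw [← hw] at hadv
    obtain ⟨w₁, ha, hw₁⟩ := Advances.lift (Sum.inr_injective (α := T₁.Reg))
      (Sum.inr δ.src : (T₁.State × Bool) ⊕ T₂.State) (.inr δ.tgt) hadv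
    obtain ⟨δs', w', hr, ho⟩ := ih w₁ hw₁
    refine ⟨SRT.liftRight T₁ T₂ δ :: δs', w', ?_, fun _ => ho _⟩
    rw [← mark_lift (Sum.inr : T₂.Reg → T₁.Reg ⊕ T₂.Reg)
      (Sum.inr δ.src : (T₁.State × Bool) ⊕ T₂.State) (.inr δ.tgt) δ c.pos]
    have hstep : (concat T₁ T₂).Step S (SRT.liftRight T₁ T₂ δ)
        ⟨c.pos, .inr c.state, w⟩ ⟨d.pos, .inr d.state, w₁⟩ :=
      ⟨mem_trans_concat.2 (.inr (.inr ⟨δ, hδ, rfl⟩)), congrArg Sum.inr hsrc,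
        congrArg Sum.inr htgt, ha⟩
    exact .cons hstep hr

theorem Run.of_concat_inr {S : List U}
    {c c' : SRTConfig U (concat T₁ T₂).State (concat T₁ T₂).Reg}
    {δs : List (SRTTransition U (concat T₁ T₂).State (concat T₁ T₂).Reg)}
    {M : Finset ℕ} (h : (concat T₁ T₂).Run S c δs M c') {q q' : T₂.State}
    (hq : c.state = .inr q) (hq' : c'.state = .inr q') :
    ∃ δs', T₂.Run S ⟨c.pos, q, c.val ∘ Sum.inr⟩ δs' M ⟨c'.pos, q', c'.val ∘ Sum.inr⟩ ∧
      ∀ b, lastOut b δs' = lastOut b δs := by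
  induction h generalizing q with
  | nil c =>
    obtain rfl : q = q' := Sum.inr_injective (hq.symm.trans hq')
    exact ⟨[], .nil _, fun _ => rfl⟩
  | @cons c d _ δ _ _ hs _ ih =>
    obtain ⟨hδ, hsrc, htgt, hadv⟩ := hs
    rw [hq] at hsrc
    rcases mem_trans_concat.1 hδ with ⟨b, δ, hδ₁, rfl⟩ | ⟨q, hq, rfl⟩ | ⟨δ, hδ₂, rfl⟩
    · cases hsrc
    · cases hsrc
    · obtain ⟨δs', hr, ho⟩ := ih htgt.symm hq'
      refine ⟨δ :: δs', ?_, fun _ => ho _⟩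
      rw [SRT.liftRight, mark_lift]
      have hstep : T₂.Step S δ ⟨c.pos, q, c.val ∘ Sum.inr⟩ ⟨d.pos, δ.tgt, d.val ∘ Sum.inr⟩ :=
        ⟨hδ₂, Sum.inr_injective hsrc, rfl, Advances.of_lift Sum.inr_injective hadv⟩
      exact .cons hstep hr

theorem Run.of_concat_inl {S : List U}
    {c c' : SRTConfig U (concat T₁ T₂).State (concat T₁ T₂).Reg}
    {δs : List (SRTTransition U (concat T₁ T₂).State (concat T₁ T₂).Reg)}
    {M : Finset ℕ} (h : (concat T₁ T₂).Run S c δs M c') {q : T₁.State} {b : Bool} {q' : T₂.State}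
    (hq : c.state = .inl (q, b)) (hq' : c'.state = .inr q') :
    ∃ δs₁ δs₂ M₁ M₂ p q₁ v₁, M = M₁ ∪ M₂ ∧
      T₁.Run S ⟨c.pos, q, c.val ∘ Sum.inl⟩ δs₁ M₁ ⟨p, q₁, v₁⟩ ∧ q₁ ∈ T₁.final ∧
      lastOut b δs₁ = true ∧
      T₂.Run S ⟨p, T₂.start, c.val ∘ Sum.inr⟩ δs₂ M₂ ⟨c'.pos, q', c'.val ∘ Sum.inr⟩ ∧
      ∀ b', lastOut b' δs = lastOut false δs₂ := by
  induction h generalizing q b with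
  | nil c => rw [hq] at hq'; cases hq'
  | @cons c d _ δ _ M hs hrun ih =>
    obtain ⟨hδ, hsrc, htgt, hadv⟩ := hs
    rw [hq] at hsrc
    rcases mem_trans_concat.1 hδ with ⟨b', δ, hδ₁, rfl⟩ | ⟨q₁, hq₁, rfl⟩ | ⟨δ, hδ₂, rfl⟩
    · obtain ⟨δs₁, δs₂, M₁, M₂, p, q₁, v₁, rfl, hr, hf, ho, hr₂, ho₂⟩ := ih htgt.symm hq'
      have hv : d.val ∘ Sum.inr = c.val ∘ Sum.inr := by
        funext r
        exact Advances.val_eq_of_notMem_range hadv (by simp)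
      rw [hv] at hr₂
      refine ⟨δ :: δs₁, δs₂, δ.mark c.pos ∪ M₁, M₂, p, q₁, v₁, ?_, ?_, hf, ho, hr₂,
        fun _ => ho₂ _⟩
      · rw [SRT.liftLeft, mark_lift, Finset.union_assoc]
      · have hstep : T₁.Step S δ ⟨c.pos, q, c.val ∘ Sum.inl⟩ ⟨d.pos, δ.tgt, d.val ∘ Sum.inl⟩ :=
          ⟨hδ₁, congrArg Prod.fst (Sum.inl_injective hsrc), rfl,
            Advances.of_lift Sum.inl_injective hadv⟩
        exact .cons hstep hr
    · obtain ⟨rfl, rfl⟩ : q₁ = q ∧ true = b := Prod.mk.inj (Sum.inl_injective hsrc)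
      obtain ⟨δs₂, hr, ho⟩ := hrun.of_concat_inr htgt.symm hq'
      rcases hadv with ⟨-, hp, hv⟩ | ⟨_, _, h, -⟩
      · rw [hp, hv] at hr
        exact ⟨[], δs₂, ∅, M, c.pos, q₁, _, rfl, .nil _, hq₁, rfl, hr, fun _ => (ho false).symm⟩
      · cases h
    · cases hsrc

theorem accMatch_concat_iff {S : List U} {M : Finset ℕ} :
    (concat T₁ T₂).AccMatch S M ↔ ∃ (S₁ S₂ : List U) (M₁ M₂ : Finset ℕ),
      S = S₁ ++ S₂ ∧ T₁.AccMatch S₁ M₁ ∧ T₂.AccMatch S₂ M₂ ∧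
        MatchCat M₁ (M₂.image (· + S₁.length)) M := by
  simp only [accMatch_iff]
  constructor
  · rintro ⟨δs, _, v, hr, ⟨q, hq, rfl⟩, ho⟩
    obtain ⟨δs₁, δs₂, M₁, M₂, p, q₁, v₁, rfl, hr₁, hq₁, ho₁, hr₂, ho₂⟩ :=
      hr.of_concat_inl (q' := q) rfl rfl
    have hp : 1 ≤ p := hr₁.pos_le
    have hp' : p ≤ S.length + 1 := hr₂.pos_le
    obtain ⟨S₁, S₂, rfl, hS₁⟩ : ∃ S₁ S₂, S = S₁ ++ S₂ ∧ p = S₁.length + 1 :=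
      ⟨S.take (p - 1), S.drop (p - 1), (List.take_append_drop _ _).symm, by simp; omega⟩
    subst hS₁
    have hM₁ := hr₁.match_subset
    have hM₂ := hr₂.match_subset
    obtain ⟨M₂, rfl, hr₂'⟩ := hr₂.of_shift le_rfl
    have hlt : ∀ i ∈ M₁, ∀ j ∈ M₂.image (· + S₁.length), i < j := fun i hi j hj =>
      (Finset.mem_Ico.1 (hM₁ hi)).2.trans_le (Finset.mem_Ico.1 (hM₂ hj)).1
    refine ⟨S₁, S₂, M₁, M₂, rfl, ⟨δs₁, q₁, v₁, hr₁.of_append_string le_rfl le_rfl, hq₁, ho₁⟩,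
      ⟨δs₂, q, v ∘ Sum.inr, ?_, hq, (ho₂ false).symm.trans ho⟩, ?_, rfl, hlt⟩
    · have hlen : (S₁ ++ S₂).length + 1 - S₁.length = S₂.length + 1 := by
        rw [List.length_append]; omega
      simp only [Nat.add_sub_cancel_left, hlen] at hr₂'
      exact hr₂'
    · exact Finset.disjoint_left.2 fun i hi hi' => (hlt i hi i hi').false
  · rintro ⟨S₁, S₂, M₁, M₂, rfl, ⟨δs₁, q₁, v₁, hr₁, hq₁, ho₁⟩, ⟨δs₂, q₂, v₂, hr₂, hq₂, ho₂⟩,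
      -, rfl, -⟩
    obtain ⟨δs, w, hr, -, hw⟩ := (hr₁.append_string S₂).liftLeft (T₂ := T₂) false Val.sharp rfl
    obtain ⟨δs', w', hr', ho'⟩ := (hr₂.shift S₁ le_rfl).liftRight (T₁ := T₁) w hw
    rw [ho₁] at hr
    have hb : (concat T₁ T₂).Step (S₁ ++ S₂) (bridge T₁ T₂ q₁)
        ⟨S₁.length + 1, .inl (q₁, true), w⟩ ⟨1 + S₁.length, .inr T₂.start, w⟩ :=
      ⟨mem_trans_concat.2 (.inr (.inl ⟨q₁, hq₁, rfl⟩)), rfl, rfl, .inl ⟨rfl, add_comm _ _, rfl⟩⟩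
    refine ⟨δs ++ bridge T₁ T₂ q₁ :: δs', .inr q₂, w', ?_, ⟨q₂, hq₂, rfl⟩, ?_⟩
    · have h := hr.append (.cons hb hr')
      have hm : (bridge T₁ T₂ q₁).mark (S₁.length + 1) = ∅ := rfl
      rw [hm, Finset.empty_union] at h
      have hlen : (S₁ ++ S₂).length + 1 = S₂.length + 1 + S₁.length := by
        rw [List.length_append]; omega
      rw [hlen]
      exact h
    · rw [lastOut_append, lastOut_cons]
      exact (ho' false).trans ho₂

end Concat

end SRT

/-- SRT are closed under concatenation: `M` is a match of `T`
on `S` iff `S` decomposes as `S₁ · S₂`, `M₁` is a match of `T₁` on `S₁`, `M₂`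
is a match of `T₂` on `S₂` (its positions shifted by `|S₁|` to refer to
absolute positions of `S`) and `M = M₁ · M₂`. -/
theorem srt_closed_concat {U : Type*} [Nonempty U] (T₁ T₂ : SRT U) :
    ∃ T : SRT U, ∀ (S : List U) (M : Finset ℕ),
      M ∈ T.MatchSet S ↔
        ∃ (S₁ S₂ : List U) (M₁ M₂ : Finset ℕ),
          S = S₁ ++ S₂ ∧ M₁ ∈ T₁.MatchSet S₁ ∧ M₂ ∈ T₂.MatchSet S₂ ∧
            MatchCat M₁ (M₂.image (· + S₁.length)) M := by
  exact ⟨SRT.concat T₁ T₂, fun _ _ => SRT.accMatch_concat_iff⟩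
end

section
/- SRT are not closed under complement: if U is infinite, there exists an SRT T over U with Lang_oa(T) = {S = t₁⋯tₙ over U : t_i = t_j for some i < j} such that no SRT T_c over U satisfies Lang_oa(T_c) = {S over U : the elements of S are pairwise distinct}, i.e. no SRT accepts the complement of Lang_oa(T) in the set of all strings over U. -/
open scoped Classical

/-- `c'` is reachable from `c` while reading `S`. -/
def SRT.Reaches {U : Type*} (T : SRT U) (S : List U) :
    SRTConfig U T.State T.Reg → SRTConfig U T.State T.Reg → Prop :=
  Relation.ReflTransGen fun c c' => ∃ δ, T.Step S δ c c'

theorem SRT.reaches_iff_exists_run {U : Type*} {T : SRT U} {S : List U}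
    {c c' : SRTConfig U T.State T.Reg} :
    T.Reaches S c c' ↔ ∃ δs M, T.Run S c δs M c' := by
  constructor
  · intro h
    induction h using Relation.ReflTransGen.head_induction_on with
    | refl => exact ⟨_, _, .nil _⟩
    | head h _ ih =>
      obtain ⟨δ, hδ⟩ := h
      obtain ⟨δs, M, hr⟩ := ih
      exact ⟨_, _, .cons hδ hr⟩
  · rintro ⟨δs, M, h⟩
    induction h with
    | nil => exact .refl
    | cons h _ ih => exact .head ⟨_, h⟩ ih

theorem SRT.mem_langOA_iff {U : Type*} {T : SRT U} {S : List U} :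
    S ∈ T.LangOA ↔ ∃ q ∈ T.final, ∃ v, T.Reaches S T.init ⟨S.length + 1, q, v⟩ := by
  simp only [SRT.LangOA, Set.mem_ofPred_eq, SRT.reaches_iff_exists_run]
  constructor
  · rintro ⟨δs, M, q, v, h, hq⟩
    exact ⟨q, hq, v, δs, M, h⟩
  · rintro ⟨q, hq, v, δs, M, h⟩
    exact ⟨δs, M, q, v, h, hq⟩

theorem SRT.Step.pos_eq_or {U : Type*} {T : SRT U} {S : List U}
    {δ : SRTTransition U T.State T.Reg} {c c' : SRTConfig U T.State T.Reg}
    (h : T.Step S δ c c') : c'.pos = c.pos ∨ c'.pos = c.pos + 1 := by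
  obtain ⟨-, -, -, ⟨-, h, -⟩ | ⟨_, _, -, -, -, h, -⟩⟩ := h <;> simp [h]

theorem SRT.Reaches.pos_le {U : Type*} {T : SRT U} {S : List U}
    {c c' : SRTConfig U T.State T.Reg} (h : T.Reaches S c c') : c.pos ≤ c'.pos := by
  induction h with
  | refl => exact le_rfl
  | tail _ h ih =>
    obtain ⟨δ, h⟩ := h
    have := h.pos_eq_or
    omega

/-- A run from `c` to `c'` only depends on the elements it reads. -/
theorem SRT.Reaches.congr {U : Type*} {T : SRT U} {S S' : List U}
    {c c' : SRTConfig U T.State T.Reg} (h : T.Reaches S c c')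
    (hS : ∀ j, c.pos ≤ j → j < c'.pos → S[j - 1]? = S'[j - 1]?) : T.Reaches S' c c' := by
  induction h with
  | refl => exact .refl
  | @tail b d hb h ih =>
    obtain ⟨δ, h⟩ := h
    have hle := SRT.Reaches.pos_le hb
    have hpos := h.pos_eq_or
    refine .tail (ih fun j h₁ h₂ => hS j h₁ (by omega)) ⟨δ, ?_⟩
    obtain ⟨hδ, hs, ht, h | ⟨φ, u, hφ, hu, hsat, hp, hv⟩⟩ := h
    · exact ⟨hδ, hs, ht, .inl h⟩
    · exact ⟨hδ, hs, ht, .inr ⟨φ, u, hφ, hS b.pos hle (by omega) ▸ hu, hsat, hp, hv⟩⟩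

theorem SRT.Reaches.exists_pos_eq {U : Type*} {T : SRT U} {S : List U}
    {c c' : SRTConfig U T.State T.Reg} (h : T.Reaches S c c') {p : ℕ}
    (hc : c.pos ≤ p) (hp : p ≤ c'.pos) :
    ∃ d, d.pos = p ∧ T.Reaches S c d ∧ T.Reaches S d c' := by
  induction h with
  | refl => exact ⟨_, le_antisymm hc hp, .refl, .refl⟩
  | @tail b d hb h ih =>
    by_cases hpb : p ≤ b.pos
    · obtain ⟨e, he, hce, heb⟩ := ih hpb
      exact ⟨e, he, hce, .tail heb h⟩
    · have hd : d.pos = p := by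
        obtain ⟨δ, h⟩ := h
        have := h.pos_eq_or
        omega
      exact ⟨d, hd, .tail hb h, .refl⟩

theorem SRT.Reaches.mem_of_val_eq_some {U : Type*} {T : SRT U} {S : List U}
    {c : SRTConfig U T.State T.Reg} (h : T.Reaches S T.init c) {r : T.Reg} {u : U}
    (hr : c.val r = some u) : u ∈ S := by
  induction h with
  | refl => simp [SRT.init, Val.sharp] at hr
  | tail _ h ih =>
    obtain ⟨δ, -, -, -, ⟨-, -, hv⟩ | ⟨φ, x, -, hx, -, -, hv⟩⟩ := h
    · exact ih (hv ▸ hr)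
    · rw [hv, Val.updateW] at hr
      split_ifs at hr
      · cases hr
        exact List.mem_of_getElem? hx
      · exact ih hr

/-- The prefix of an accepted string leads to a configuration from which the suffix is accepted. -/
theorem SRT.exists_config_of_append_mem_langOA {U : Type*} {T : SRT U} {A B : List U}
    (h : A ++ B ∈ T.LangOA) :
    ∃ (q : T.State) (v : Val U T.Reg), (∀ r u, v r = some u → u ∈ A) ∧
      T.Reaches A T.init ⟨A.length + 1, q, v⟩ ∧
      ∃ q' ∈ T.final, ∃ v', T.Reaches (A ++ B) ⟨A.length + 1, q, v⟩
        ⟨(A ++ B).length + 1, q', v'⟩ := by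
  obtain ⟨q', hq', v', h⟩ := SRT.mem_langOA_iff.1 h
  obtain ⟨⟨p, q, v⟩, rfl, h₁, h₂⟩ := h.exists_pos_eq (p := A.length + 1)
    (by simp [SRT.init]) (by simp)
  have h₁' : T.Reaches A T.init ⟨A.length + 1, q, v⟩ := by
    refine h₁.congr fun j hj hj' => ?_
    simp only [SRT.init] at hj hj'
    rw [List.getElem?_append_left (by omega)]
  exact ⟨q, v, fun r u hr => h₁'.mem_of_val_eq_some hr, h₁', q', hq', v', h₂⟩

/-- Runs of a transducer that agree after reading prefixes of the same length can be spliced. -/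
theorem SRT.append_mem_langOA_of_reaches {U : Type*} {T : SRT U} {A A' B : List U}
    (hlen : A.length = A'.length) {q q' : T.State} {v v' : Val U T.Reg}
    (h : T.Reaches A T.init ⟨A.length + 1, q, v⟩)
    (h' : T.Reaches (A' ++ B) ⟨A'.length + 1, q, v⟩ ⟨(A' ++ B).length + 1, q', v'⟩)
    (hq' : q' ∈ T.final) : A ++ B ∈ T.LangOA := by
  refine SRT.mem_langOA_iff.2 ⟨q', hq', v', ?_⟩
  have h₁ : T.Reaches (A ++ B) T.init ⟨A.length + 1, q, v⟩ := by
    refine h.congr fun j hj hj' => ?_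
    simp only [SRT.init] at hj hj'
    rw [List.getElem?_append_left (by omega)]
  have h₂ : T.Reaches (A ++ B) ⟨A'.length + 1, q, v⟩ ⟨(A' ++ B).length + 1, q', v'⟩ := by
    refine h'.congr fun j hj _ => ?_
    simp only at hj
    rw [List.getElem?_append_right (by omega), List.getElem?_append_right (by omega), hlen]
  simp only [List.length_append, hlen] at h₁ h₂ ⊢
  exact h₁.trans h₂

theorem exists_mul_pow_lt_two_pow (c k : ℕ) : ∃ n : ℕ, c * (n * 2 + 1) ^ k < 2 ^ n := by
  have h := tendsto_pow_const_div_const_pow_of_one_lt k (r := (2 : ℝ)) one_lt_two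
  have hpos : (0 : ℝ) < 1 / (c * 3 ^ k + 1) := by positivity
  obtain ⟨n, hn, hn1⟩ := ((h.eventually_lt_const hpos).and
    (Filter.eventually_ge_atTop 1)).exists
  refine ⟨n, ?_⟩
  rw [div_lt_div_iff₀ (by positivity) (by positivity)] at hn
  have hn' : n ^ k * (c * 3 ^ k + 1) < 2 ^ n := by
    rw [one_mul] at hn
    exact_mod_cast hn
  calc c * (n * 2 + 1) ^ k ≤ c * (3 * n) ^ k := by gcongr; omega
    _ = n ^ k * (c * 3 ^ k) := by rw [mul_pow]; ring
    _ ≤ n ^ k * (c * 3 ^ k + 1) := by gcongr; omega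
    _ < 2 ^ n := hn'

/-- No transducer accepts exactly the strings with pairwise distinct elements: split a set of
`2 * n` elements into `n` pairs, and let the prefix of length `n` pick one element of each pair.
For large `n` there are more prefixes than configurations. -/
theorem SRT.langOA_ne_setOf_nodup {U : Type*} [Infinite U] (T : SRT U) :
    T.LangOA ≠ {S : List U | S.Nodup} := by
  intro hT
  have := T.stateFinite
  have := T.regFinite
  have := Fintype.ofFinite T.State
  have := Fintype.ofFinite T.Reg
  obtain ⟨n, hn⟩ := exists_mul_pow_lt_two_pow (Fintype.card T.State) (Fintype.card T.Reg)
  let e : Fin n × Bool ↪ U :=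
    (⟨Encodable.encode, Encodable.encode_injective⟩ : Fin n × Bool ↪ ℕ).trans
      (Infinite.natEmbedding U)
  let pre (f : Fin n → Bool) : List U := List.ofFn fun i => e (i, f i)
  let suf (f : Fin n → Bool) : List U := List.ofFn fun i => e (i, !f i)
  have hmem (f : Fin n → Bool) : pre f ++ suf f ∈ T.LangOA := by
    rw [hT, Set.mem_ofPred_eq, List.nodup_append, List.nodup_ofFn, List.nodup_ofFn]
    refine ⟨fun i j h => ?_, fun i j h => ?_, fun a ha b hb => ?_⟩
    · exact congrArg Prod.fst (e.injective h)
    · exact congrArg Prod.fst (e.injective h)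
    · obtain ⟨i, rfl⟩ := List.mem_ofFn.1 ha
      obtain ⟨j, rfl⟩ := List.mem_ofFn.1 hb
      intro h
      have h := e.injective h
      simp only [Prod.mk.injEq] at h
      obtain ⟨rfl, h⟩ := h
      simp at h
  choose q v hv hpre hsuf using fun f => SRT.exists_config_of_append_mem_langOA (hmem f)
  let vals : Finset (Option U) := insert none ((Finset.univ.map e).image some)
  let target : Finset (T.State × Val U T.Reg) :=
    Finset.univ ×ˢ Fintype.piFinset fun _ => vals
  have hvals : vals.card ≤ n * 2 + 1 := by
    refine (Finset.card_insert_le _ _).trans (Nat.succ_le_succ ?_)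
    refine Finset.card_image_le.trans ?_
    simp
  have hcard : target.card < (Finset.univ : Finset (Fin n → Bool)).card := by
    simp only [target, Finset.card_product, Fintype.card_piFinset, Finset.prod_const,
      Finset.card_univ, Fintype.card_fun, Fintype.card_bool, Fintype.card_fin]
    refine lt_of_le_of_lt ?_ hn
    gcongr
  have hmaps : Set.MapsTo (fun f => (q f, v f))
      ((Finset.univ : Finset (Fin n → Bool)) : Set (Fin n → Bool)) target := by
    intro f _
    simp only [target, Finset.mem_coe, Finset.mem_product, Finset.mem_univ, true_and,
      Fintype.mem_piFinset]
    intro r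
    cases hr : v f r with
    | none => simp [vals]
    | some u =>
      obtain ⟨i, rfl⟩ := List.mem_ofFn.1 (hv f r u hr)
      exact Finset.mem_insert_of_mem (Finset.mem_image_of_mem _
        (Finset.mem_map_of_mem _ (Finset.mem_univ _)))
  obtain ⟨f, -, g, -, hfg, heq⟩ := Finset.exists_ne_map_eq_of_card_lt_of_maps_to hcard hmaps
  obtain ⟨hq, hv⟩ := Prod.mk.inj heq
  obtain ⟨q', hq', v', hrun⟩ := hsuf g
  have hlen : (pre f).length = (pre g).length := by simp [pre]
  have hbad : pre f ++ suf g ∈ T.LangOA :=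
    SRT.append_mem_langOA_of_reaches hlen (hq ▸ hv ▸ hpre f) hrun hq'
  rw [hT, Set.mem_ofPred_eq, List.nodup_append] at hbad
  obtain ⟨i, hi⟩ := Function.ne_iff.1 hfg
  refine hbad.2.2 _ (List.mem_ofFn.2 ⟨i, rfl⟩) _ (List.mem_ofFn.2 ⟨i, rfl⟩) ?_
  rw [Bool.eq_not.2 hi]

/-- The transition that stays in state `q` without touching the register. -/
def skipTransition (U : Type*) (q : Fin 3) : SRTTransition U (Fin 3) Unit :=
  ⟨q, some fun _ _ => True, ∅, q, false⟩

/-- The transition that stores the current element. -/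
def storeTransition (U : Type*) : SRTTransition U (Fin 3) Unit :=
  ⟨0, some fun _ _ => True, Set.univ, 1, false⟩

/-- The transition that compares the current element with the stored one. -/
def compareTransition (U : Type*) : SRTTransition U (Fin 3) Unit :=
  ⟨1, some fun u v => v () = some u, ∅, 2, true⟩

/-- The transducer that guesses an element, stores it, and looks for another occurrence of it. -/
def repeatSRT (U : Type*) : SRT U where
  State := Fin 3
  Reg := Unit
  stateFinite := inferInstance
  regFinite := inferInstance
  start := 0
  final := {2}
  trans := insert (storeTransition U) (insert (compareTransition U) (Set.range (skipTransition U)))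
  transFinite := ((Set.finite_range _).insert _).insert _

theorem repeatSRT_reaches_skip {U : Type*} {S : List U} (q : Fin 3) (v : Val U Unit) (p k : ℕ)
    (h : p + k ≤ S.length) :
    (repeatSRT U).Reaches S ⟨p + 1, q, v⟩ ⟨p + k + 1, q, v⟩ := by
  induction k with
  | zero => exact .refl
  | succ k ih =>
    refine .tail (ih (by omega)) ⟨skipTransition U q, ?_, rfl, rfl, .inr ⟨_, S[p + k], rfl, ?_,
      trivial, rfl, (Val.updateW_empty _ _).symm⟩⟩
    · exact .inr (.inr ⟨q, rfl⟩)
    · simp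

/-- The invariant satisfied by the reachable configurations of `repeatSRT`. -/
def RepeatInvariant {U : Type*} (S : List U) (c : SRTConfig U (Fin 3) Unit) : Prop :=
  1 ≤ c.pos ∧
    (c.state = 1 → ∃ i < c.pos - 1, S[i]? = c.val ()) ∧
    (c.state = 2 → ∃ (i j : ℕ) (u : U), i < j ∧ S[i]? = some u ∧ S[j]? = some u)

theorem repeatSRT_invariant {U : Type*} {S : List U} {c : SRTConfig U (Fin 3) Unit}
    (h : (repeatSRT U).Reaches S (repeatSRT U).init c) : RepeatInvariant S c := by
  induction h with
  | refl => simp [RepeatInvariant, SRT.init, repeatSRT]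
  | @tail b d _ h ih =>
    obtain ⟨pb, qb, vb⟩ := b
    obtain ⟨pd, qd, vd⟩ := d
    obtain ⟨h0, h1, h2⟩ := ih
    obtain ⟨δ, hδ, hs, ht, hstep⟩ := h
    simp only at h0 h1 h2 hs ht hstep
    rcases hδ with rfl | rfl | ⟨q, rfl⟩
    · obtain ⟨hc, -⟩ | ⟨φ, u, hc, hu, hφ, hp, hv⟩ := hstep
      · simp [storeTransition] at hc
      · subst hp hv ht
        refine ⟨by simp, fun _ => ⟨pb - 1, ?_, ?_⟩, ?_⟩
        · simp only; omega
        · exact hu.trans (if_pos (Set.mem_univ _)).symm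
        · simp [storeTransition]
    · obtain ⟨hc, -⟩ | ⟨φ, u, hc, hu, hφ, hp, hv⟩ := hstep
      · simp [compareTransition] at hc
      · obtain rfl := Option.some.inj hc
        subst hp hv ht hs
        refine ⟨by simp, by simp [compareTransition], fun _ => ?_⟩
        obtain ⟨i, hi, hiv⟩ := h1 rfl
        exact ⟨i, pb - 1, u, hi, hiv.trans hφ, hu⟩
    · obtain ⟨hc, -⟩ | ⟨φ, u, hc, hu, hφ, hp, hv⟩ := hstep
      · simp [skipTransition] at hc
      · have hv' : vd = vb := hv.trans (Val.updateW_empty _ _)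
        subst hp hv' ht hs
        refine ⟨by simp, fun hq => ?_, h2⟩
        obtain ⟨i, hi, hiv⟩ := h1 hq
        exact ⟨i, by simp only; omega, hiv⟩

theorem repeatSRT_langOA (U : Type*) :
    (repeatSRT U).LangOA = {S : List U | ∃ (i j : ℕ) (hij : i < j) (hj : j < S.length),
      S[i]'(lt_trans hij hj) = S[j]'hj} := by
  ext S
  rw [SRT.mem_langOA_iff, Set.mem_ofPred_eq]
  constructor
  · rintro ⟨q, rfl, v, h⟩
    obtain ⟨i, j, u, hij, hi, hj⟩ := (repeatSRT_invariant h).2.2 rfl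
    obtain ⟨hi', hi⟩ := List.getElem?_eq_some_iff.1 hi
    obtain ⟨hj', hj⟩ := List.getElem?_eq_some_iff.1 hj
    exact ⟨i, j, hij, hj', hi.trans hj.symm⟩
  · rintro ⟨i, j, hij, hj, heq⟩
    let v : Val U Unit := Val.sharp.updateW Set.univ S[i]
    refine ⟨(2 : Fin 3), rfl, v, ?_⟩
    have h₁ := repeatSRT_reaches_skip (S := S) 0 Val.sharp 0 i (by omega)
    have h₂ : (repeatSRT U).Step S (storeTransition U)
        ⟨0 + i + 1, (0 : Fin 3), Val.sharp⟩ ⟨i + 1 + 1, (1 : Fin 3), v⟩ :=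
      ⟨.inl rfl, rfl, rfl, .inr ⟨_, S[i], rfl, by simp, trivial, by simp, rfl⟩⟩
    have h₃ := repeatSRT_reaches_skip (S := S) 1 v (i + 1) (j - (i + 1)) (by omega)
    rw [show i + 1 + (j - (i + 1)) = j by omega] at h₃
    have h₄ : (repeatSRT U).Step S (compareTransition U)
        ⟨j + 1, (1 : Fin 3), v⟩ ⟨j + 1 + 1, (2 : Fin 3), v⟩ :=
      ⟨.inr (.inl rfl), rfl, rfl, .inr ⟨_, S[j], rfl, by simp, by simp [v, Val.updateW, heq],
        rfl, (Val.updateW_empty _ _).symm⟩⟩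
    have h₅ := repeatSRT_reaches_skip (S := S) 2 v (j + 1) (S.length - (j + 1)) (by omega)
    rw [show j + 1 + (S.length - (j + 1)) = S.length by omega] at h₅
    exact ((Relation.ReflTransGen.tail h₁ ⟨_, h₂⟩).trans
      (Relation.ReflTransGen.tail h₃ ⟨_, h₄⟩)).trans h₅

/-- SRT are not closed under complement: over an infinite
universe, there is an SRT whose output-agnostic language consists of the
strings containing two equal elements, while no SRT accepts (output-
agnostically) exactly the strings whose elements are pairwise distinct. -/
theorem srt_not_closed_complement {U : Type*} [Infinite U] :
    ∃ T : SRT U,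
      T.LangOA = {S : List U | ∃ (i j : ℕ) (hij : i < j) (hj : j < S.length),
        S[i]'(lt_trans hij hj) = S[j]'hj} ∧
      ∀ Tc : SRT U,
        Tc.LangOA ≠ {S : List U |
          ∀ (i j : ℕ) (hi : i < S.length) (hj : j < S.length),
            i ≠ j → S[i]'hi ≠ S[j]'hj} := by
  refine ⟨repeatSRT U, repeatSRT_langOA U, fun Tc h => Tc.langOA_ne_setOf_nodup (h.trans ?_)⟩
  ext S
  rw [Set.mem_ofPred_eq, Set.mem_ofPred_eq, List.nodup_iff_injective_get]
  constructor
  · intro h i j hij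
    by_contra hne
    exact h i j i.2 j.2 (fun h' => hne (Fin.ext h')) hij
  · intro h i j hi hj hne heq
    exact hne (congrArg Fin.val (@h ⟨i, hi⟩ ⟨j, hj⟩ heq))
end
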